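/- arXiv:2309.02132 — 2 statements merged into one kernel-verified Lean document; each statement's English description precedes it below -/
import Mathlib

section
/- Promising graph, type 3: Suppose that in a play of the (K^{ℵ0}, K^4)-building game it is the first player's turn, and there are six distinct vertices a, b, c, d, e, f such that the edges ab, ac, ad, ae, af, bc are red, the edges bd, be are blue, and all other edges among {a, b, c, d, e, f} are unclaimed (in particular the vulnerable edges bf and ce are unclaimed). Suppose further that on the whole board, even after adding bf and ce as blue edges, the blue edges contain no K^4 and admit no blue threat. Then the first player has a winning strategy from this position: each of her moves before the last creates a red threat, and she completes a red K^4 within at most 4 further moves of hers (she begins by claiming cf, and if the second player answers bf, the induced position on {a, c, d, e, f} is a realised promising graph of type 2). -/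
/-!
Positions in the `(K^{ℵ₀}, K^4)`-building game.  A position is a pair `(R, B)`
of disjoint finite sets of red (first player's) and blue (second player's)
edges of the complete graph on `ℕ`; an edge is unclaimed if it lies in neither
set.
-/

/-- A history of further moves played from a position, in chronological order;
the player to move plays at even indices, the other player at odd indices. -/
abbrev Hist : Type := List (Sym2 ℕ)

/-- A strategy: assigns to each sequence of previously claimed edges an edge. -/
abbrev Strategy : Type := Hist → Sym2 ℕ

/-- The edges claimed at even indices of a history. -/
def firstPlayerEdges (h : Hist) : Set (Sym2 ℕ) :=
  {x | ∃ i : Fin h.length, (i : ℕ) % 2 = 0 ∧ h.get i = x}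

/-- The edges claimed at odd indices of a history. -/
def secondPlayerEdges (h : Hist) : Set (Sym2 ℕ) :=
  {x | ∃ i : Fin h.length, (i : ℕ) % 2 = 1 ∧ h.get i = x}

/-- The red edges after the further moves `h` have been played from a position
with red edges `R`, the first player (red) moving at even indices. -/
def redAfter (R : Finset (Sym2 ℕ)) (h : Hist) : Set (Sym2 ℕ) :=
  ↑R ∪ firstPlayerEdges h

/-- The blue edges after the further moves `h` have been played from a
position with blue edges `B`, the second player (blue) moving at odd
indices. -/
def blueAfter (B : Finset (Sym2 ℕ)) (h : Hist) : Set (Sym2 ℕ) :=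
  ↑B ∪ secondPlayerEdges h

/-- An edge is a legal move if it is a proper edge (not a loop) and is
unclaimed, i.e. lies neither in the position `(R, B)` nor in the history `h`
of further moves. -/
def LegalFrom (R B : Finset (Sym2 ℕ)) (h : Hist) (x : Sym2 ℕ) : Prop :=
  ¬ x.IsDiag ∧ x ∉ R ∧ x ∉ B ∧ x ∉ h

/-- The history of further moves after `n` moves, when the player to move
follows the strategy `σ` and the other player follows the strategy `τ`. -/
def play (σ τ : Strategy) : ℕ → Hist
  | 0 => []
  | n + 1 => play σ τ n ++ [if n % 2 = 0 then σ (play σ τ n) else τ (play σ τ n)]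

/-- `E` contains all six edges on some 4-element vertex set. -/
def HasK4 (E : Set (Sym2 ℕ)) : Prop :=
  ∃ t : Finset ℕ, t.card = 4 ∧ ∀ u ∈ t, ∀ v ∈ t, u ≠ v → s(u, v) ∈ E

/-- A threat for the colour with edge set `C`, the other colour having edge
set `O`: a 4-element vertex set `t` on which the edge `x` is unclaimed while
all five other edges belong to `C`. -/
def IsThreat (C O : Set (Sym2 ℕ)) (t : Finset ℕ) (x : Sym2 ℕ) : Prop :=
  t.card = 4 ∧ (∃ u ∈ t, ∃ v ∈ t, u ≠ v ∧ x = s(u, v)) ∧ x ∉ C ∧ x ∉ O ∧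
    ∀ u ∈ t, ∀ v ∈ t, u ≠ v → s(u, v) ≠ x → s(u, v) ∈ C

/-- The colour with edge set `C` admits a threat (the other colour having edge
set `O`). -/
def HasThreat (C O : Set (Sym2 ℕ)) : Prop := ∃ t x, IsThreat C O t x

/-- From the position `(R, B)` with the first player (red) to move, the first
player has a winning strategy which completes a red `K^4` within at most
`(bound + 1) / 2` further moves of hers, each of her moves before the last
creating a red threat: against every legally playing opponent there is an odd
stage `n ≤ bound` (a stage just after one of her own moves, her `r`-th further
move being move number `2 * r - 1`) at which, all of her moves having been
legal and each of her moves before the last having created a red threat, the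
red edges contain a `K^4` while the blue edges do not. -/
def WinsFromWithinThreats (R B : Finset (Sym2 ℕ)) (bound : ℕ) : Prop :=
  ∃ σ : Strategy, ∀ τ : Strategy,
    (∀ n, n % 2 = 1 → (∃ x, LegalFrom R B (play σ τ n) x) →
      LegalFrom R B (play σ τ n) (τ (play σ τ n))) →
    ∃ n ≤ bound, n % 2 = 1 ∧
      (∀ m < n, m % 2 = 0 → LegalFrom R B (play σ τ m) (σ (play σ τ m))) ∧
      (∀ m, m % 2 = 0 → m + 1 < n →
        HasThreat (redAfter R (play σ τ (m + 1)))
          (blueAfter B (play σ τ (m + 1)))) ∧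
      HasK4 (redAfter R (play σ τ n)) ∧ ¬ HasK4 (blueAfter B (play σ τ n))

@[simp]
theorem firstPlayerEdges_nil : firstPlayerEdges [] = ∅ := by
  ext y; simp [firstPlayerEdges]

@[simp]
theorem secondPlayerEdges_nil : secondPlayerEdges [] = ∅ := by
  ext y; simp [secondPlayerEdges]

@[simp]
theorem firstPlayerEdges_cons (x : Sym2 ℕ) (h : Hist) :
    firstPlayerEdges (x :: h) = insert x (secondPlayerEdges h) := by
  ext y
  simp only [firstPlayerEdges, secondPlayerEdges, Set.mem_ofPred_eq, Set.mem_insert_iff]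
  constructor
  · rintro ⟨⟨_ | i, hi⟩, hpar, rfl⟩
    · simp
    · exact Or.inr ⟨⟨i, by simpa using hi⟩, by simp at hpar ⊢; omega, by simp⟩
  · rintro (rfl | ⟨⟨i, hi⟩, hpar, rfl⟩)
    · exact ⟨⟨0, by simp⟩, by simp, by simp⟩
    · exact ⟨⟨i + 1, by simpa using hi⟩, by simp at hpar ⊢; omega, by simp⟩

@[simp]
theorem secondPlayerEdges_cons (x : Sym2 ℕ) (h : Hist) :
    secondPlayerEdges (x :: h) = firstPlayerEdges h := by
  ext y
  simp only [firstPlayerEdges, secondPlayerEdges, Set.mem_ofPred_eq]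
  constructor
  · rintro ⟨⟨_ | i, hi⟩, hpar, rfl⟩
    · simp at hpar
    · exact ⟨⟨i, by simpa using hi⟩, by simp at hpar ⊢; omega, by simp⟩
  · rintro ⟨⟨i, hi⟩, hpar, rfl⟩
    exact ⟨⟨i + 1, by simpa using hi⟩, by simp at hpar ⊢; omega, by simp⟩

theorem HasK4.mono {E F : Set (Sym2 ℕ)} (hEF : E ⊆ F) : HasK4 E → HasK4 F := by
  rintro ⟨t, ht, h⟩
  exact ⟨t, ht, fun u hu v hv huv => hEF (h u hu v hv huv)⟩

theorem hasK4_of_edges {E : Set (Sym2 ℕ)} {u v w x : ℕ} (hnodup : [u, v, w, x].Nodup)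
    (huv : s(u, v) ∈ E) (huw : s(u, w) ∈ E) (hux : s(u, x) ∈ E) (hvw : s(v, w) ∈ E)
    (hvx : s(v, x) ∈ E) (hwx : s(w, x) ∈ E) : HasK4 E := by
  refine ⟨[u, v, w, x].toFinset, List.toFinset_card_of_nodup hnodup, ?_⟩
  intro p hp q hq hpq
  simp only [List.mem_toFinset, List.mem_cons, List.not_mem_nil, or_false] at hp hq
  rcases hp with rfl | rfl | rfl | rfl <;> rcases hq with rfl | rfl | rfl | rfl <;>
    first
      | exact absurd rfl hpq
      | assumption
      | (rw [Sym2.eq_swap]; assumption)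

theorem hasThreat_of_edges {C O : Set (Sym2 ℕ)} {u v w x : ℕ} (hnodup : [u, v, w, x].Nodup)
    (huv : s(u, v) ∈ C) (huw : s(u, w) ∈ C) (hux : s(u, x) ∈ C) (hvw : s(v, w) ∈ C)
    (hvx : s(v, x) ∈ C) (hC : s(w, x) ∉ C) (hO : s(w, x) ∉ O) : HasThreat C O := by
  have hwx : w ≠ x := by simp at hnodup; tauto
  refine ⟨[u, v, w, x].toFinset, s(w, x), List.toFinset_card_of_nodup hnodup,
    ⟨w, by simp, x, by simp, hwx, rfl⟩, hC, hO, ?_⟩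
  intro p hp q hq hpq hne
  simp only [List.mem_toFinset, List.mem_cons, List.not_mem_nil, or_false] at hp hq
  rcases hp with rfl | rfl | rfl | rfl <;> rcases hq with rfl | rfl | rfl | rfl <;>
    first
      | exact absurd rfl hpq
      | exact absurd rfl hne
      | exact absurd Sym2.eq_swap hne
      | assumption
      | (rw [Sym2.eq_swap]; assumption)

/-- A colour with neither a `K^4` nor a threat cannot complete a `K^4` in one move. -/
theorem not_hasK4_insert {C O : Set (Sym2 ℕ)} {x : Sym2 ℕ} (hK4 : ¬ HasK4 C)
    (hthreat : ¬ HasThreat C O) (hx : x ∉ O) : ¬ HasK4 (insert x C) := by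
  rintro ⟨t, ht, h⟩
  by_cases hxC : x ∈ C
  · exact hK4 ⟨t, ht, by simpa only [Set.insert_eq_of_mem hxC] using h⟩
  by_cases hxt : ∃ u ∈ t, ∃ v ∈ t, u ≠ v ∧ x = s(u, v)
  · exact hthreat ⟨t, x, ht, hxt, hxC, hx, fun u hu v hv huv hne =>
      (h u hu v hv huv).resolve_left hne⟩
  · exact hK4 ⟨t, ht, fun u hu v hv huv => (h u hu v hv huv).resolve_left
      fun he => hxt ⟨u, hu, v, hv, huv, he.symm⟩⟩

/-- The first player's strategy in a promising graph of type 3: claim `cf`, `ef`, `df` in turn,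
and complete a red `K^4` as soon as the second player fails to stop one. -/
def typeThreeStrategy (b c d e f : ℕ) : Strategy
  | [_, x] => if x = s(b, f) then s(e, f) else s(b, f)
  | [_, _, _, y] => if y = s(c, e) then s(d, f) else s(c, e)
  | [_, _, _, _, _, z] => if z = s(c, d) then s(d, e) else s(c, d)
  | _ => s(c, f)

set_option maxHeartbeats 1000000 in
/-- Promising graph of type 3.  Suppose that in a play of the
`(K^{ℵ₀}, K^4)`-building game it is the first player's turn and there are six
distinct vertices `a, b, c, d, e, f` such that the edges
`ab, ac, ad, ae, af, bc` are red, the edges `bd, be` are blue, and all other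
edges among `{a, b, c, d, e, f}` (namely `bf, cd, ce, cf, de, df, ef`, in
particular the vulnerable edges `bf` and `ce`) are unclaimed.  Suppose further
that on the whole board, even after adding `bf` and `ce` as blue edges, the
blue edges contain no `K^4` and admit no blue threat.  Then the first player
has a winning strategy from this position: each of her moves before the last
creates a red threat, and she completes a red `K^4` within at most 4 further
moves of hers. -/
theorem promising_graph_type_three
    (R B : Finset (Sym2 ℕ)) (hdisj : Disjoint R B)
    (a b c d e f : ℕ)
    (hdist : ({a, b, c, d, e, f} : Finset ℕ).card = 6)
    (hab : s(a, b) ∈ R) (hac : s(a, c) ∈ R) (had : s(a, d) ∈ R)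
    (hae : s(a, e) ∈ R) (haf : s(a, f) ∈ R) (hbc : s(b, c) ∈ R)
    (hbd : s(b, d) ∈ B) (hbe : s(b, e) ∈ B)
    (hbf : s(b, f) ∉ R ∧ s(b, f) ∉ B)
    (hcd : s(c, d) ∉ R ∧ s(c, d) ∉ B)
    (hce : s(c, e) ∉ R ∧ s(c, e) ∉ B)
    (hcf : s(c, f) ∉ R ∧ s(c, f) ∉ B)
    (hde : s(d, e) ∉ R ∧ s(d, e) ∉ B)
    (hdf : s(d, f) ∉ R ∧ s(d, f) ∉ B)
    (hef : s(e, f) ∉ R ∧ s(e, f) ∉ B)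
    (hnoblueK4 : ¬ HasK4 (↑B ∪ {s(b, f), s(c, e)}))
    (hnobluethreat : ¬ HasThreat (↑B ∪ {s(b, f), s(c, e)}) ↑R) :
    WinsFromWithinThreats R B 7 := by
  have hnodup : [a, b, c, d, e, f].Nodup := by
    rw [← Multiset.coe_nodup, ← Multiset.toFinset_card_eq_card_iff_nodup]
    simpa using hdist
  simp only [List.nodup_cons, List.mem_cons, List.not_mem_nil, or_false, not_or, not_false_eq_true,
    List.nodup_nil, and_true] at hnodup
  obtain ⟨⟨ab, ac, ad, ae, af⟩, ⟨bc, bd, be, bf⟩, ⟨cd, ce, cf⟩, ⟨de, df⟩, ef⟩ := hnodup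
  have cb := Ne.symm bc
  have db := Ne.symm bd
  have eb := Ne.symm be
  have dc := Ne.symm cd
  have ec := Ne.symm ce
  have fc := Ne.symm cf
  have fd := Ne.symm df
  have fe := Ne.symm ef
  have blueSafe : ∀ x ∉ R, ∀ E : Set (Sym2 ℕ), E ⊆ insert x (↑B ∪ {s(b, f), s(c, e)}) →
      ¬ HasK4 E := fun x hx E hE hK =>
    not_hasK4_insert hnoblueK4 hnobluethreat (by simpa using hx) (hK.mono hE)
  have hcb : s(c, b) ∈ R := by rwa [Sym2.eq_swap]
  obtain ⟨σ, hσ⟩ : ∃ σ, σ = typeThreeStrategy b c d e f := ⟨_, rfl⟩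
  have σ_nil : σ [] = s(c, f) := by rw [hσ]; rfl
  have σ_two (p x) : σ [p, x] = if x = s(b, f) then s(e, f) else s(b, f) := by rw [hσ]; rfl
  have σ_four (p x q y) : σ [p, x, q, y] = if y = s(c, e) then s(d, f) else s(c, e) := by
    rw [hσ]; rfl
  have σ_six (p x q y r z) :
      σ [p, x, q, y, r, z] = if z = s(c, d) then s(d, e) else s(c, d) := by
    rw [hσ]; rfl
  clear hσ
  clear hdisj hdist hnoblueK4 hnobluethreat hbd hbe
  refine ⟨σ, fun τ hτ => ?_⟩
  have play_one : play σ τ 1 = [s(c, f)] := by simp [play, σ_nil]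
  have reply_one := hτ 1 rfl ⟨s(b, f), by simp [play_one, LegalFrom, bc, bf, hbf]⟩
  rw [play_one] at reply_one
  have play_two : play σ τ 2 = [s(c, f), τ [s(c, f)]] := by rw [play, play_one]; simp
  generalize τ [s(c, f)] = x at reply_one play_two
  obtain ⟨-, hxR, hxB, hx⟩ := reply_one
  have legal_zero : LegalFrom R B [] (σ []) := by simp [LegalFrom, σ_nil, cf, hcf]
  have threat_one : HasThreat (redAfter R [s(c, f)]) (blueAfter B [s(c, f)]) := by
    apply hasThreat_of_edges (u := a) (v := c) (w := b) (x := f) <;>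
      simp [redAfter, blueAfter, *]
  by_cases hxbf : x = s(b, f)
  swap
  · have play_three : play σ τ 3 = [s(c, f), x, s(b, f)] := by
      rw [play, play_two]; simp [σ_two, hxbf]
    refine ⟨3, by norm_num, rfl, ?_, ?_, ?_, ?_⟩
    · intro m hm hpar
      obtain rfl | rfl : m = 0 ∨ m = 2 := by omega
      · exact legal_zero
      · rw [play_two, σ_two, if_neg hxbf]
        simp [LegalFrom, bf, bc, hbf, Ne.symm hxbf]
    · intro m hpar hm
      obtain rfl : m = 0 := by omega
      rwa [zero_add, play_one]
    · rw [play_three]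
      apply hasK4_of_edges (u := a) (v := c) (w := b) (x := f) <;> simp [redAfter, *]
    · rw [play_three]
      apply blueSafe x hxR
      intro y
      simp [blueAfter]
      tauto
  subst x
  have play_three : play σ τ 3 = [s(c, f), s(b, f), s(e, f)] := by
    rw [play, play_two]; simp [σ_two]
  have legal_two : LegalFrom R B [s(c, f), s(b, f)] (σ [s(c, f), s(b, f)]) := by
    simp [LegalFrom, *]
  have threat_three : HasThreat (redAfter R [s(c, f), s(b, f), s(e, f)])
      (blueAfter B [s(c, f), s(b, f), s(e, f)]) := by
    apply hasThreat_of_edges (u := a) (v := f) (w := c) (x := e) <;>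
      simp [redAfter, blueAfter, *]
  have reply_three := hτ 3 rfl ⟨s(c, e), by simp [LegalFrom, *]⟩
  rw [play_three] at reply_three
  have play_four : play σ τ 4 = [s(c, f), s(b, f), s(e, f), τ [s(c, f), s(b, f), s(e, f)]] := by
    rw [play, play_three]; simp
  generalize τ [s(c, f), s(b, f), s(e, f)] = y at reply_three play_four
  obtain ⟨-, hyR, hyB, hy⟩ := reply_three
  by_cases hyce : y = s(c, e)
  swap
  · have play_five : play σ τ 5 = [s(c, f), s(b, f), s(e, f), y, s(c, e)] := by
      rw [play, play_four]; simp [σ_four, hyce]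
    refine ⟨5, by norm_num, rfl, ?_, ?_, ?_, ?_⟩
    · intro m hm hpar
      obtain rfl | rfl | rfl : m = 0 ∨ m = 2 ∨ m = 4 := by omega
      · exact legal_zero
      · rwa [play_two]
      · rw [play_four, σ_four, if_neg hyce]
        simp [LegalFrom, *, Ne.symm hyce]
    · intro m hpar hm
      obtain rfl | rfl : m = 0 ∨ m = 2 := by omega
      · rwa [zero_add, play_one]
      · rwa [play_three]
    · rw [play_five]
      apply hasK4_of_edges (u := a) (v := f) (w := c) (x := e) <;> simp [redAfter, *]
    · rw [play_five]
      apply blueSafe y hyR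
      intro w
      simp [blueAfter]
      tauto
  subst y
  have play_five : play σ τ 5 = [s(c, f), s(b, f), s(e, f), s(c, e), s(d, f)] := by
    rw [play, play_four]; simp [σ_four]
  have reply_five := hτ 5 rfl ⟨s(c, d), by simp [LegalFrom, *]⟩
  rw [play_five] at reply_five
  have play_six : play σ τ 6 = [s(c, f), s(b, f), s(e, f), s(c, e), s(d, f),
      τ [s(c, f), s(b, f), s(e, f), s(c, e), s(d, f)]] := by
    rw [play, play_five]; simp
  generalize τ [s(c, f), s(b, f), s(e, f), s(c, e), s(d, f)] = z at reply_five play_six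
  obtain ⟨-, hzR, hzB, hz⟩ := reply_five
  have play_seven : play σ τ 7 = [s(c, f), s(b, f), s(e, f), s(c, e), s(d, f), z,
      if z = s(c, d) then s(d, e) else s(c, d)] := by
    rw [play, play_six]; simp [σ_six]
  refine ⟨7, le_rfl, rfl, ?_, ?_, ?_, ?_⟩
  · intro m hm hpar
    obtain rfl | rfl | rfl | rfl : m = 0 ∨ m = 2 ∨ m = 4 ∨ m = 6 := by omega
    · exact legal_zero
    · rwa [play_two]
    · rw [play_four]
      simp [LegalFrom, *]
    · rw [play_six, σ_six]
      split_ifs with hzcd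
      · simp [LegalFrom, *]
      · simp [LegalFrom, *, Ne.symm hzcd]
  · intro m hpar hm
    obtain rfl | rfl | rfl : m = 0 ∨ m = 2 ∨ m = 4 := by omega
    · rwa [zero_add, play_one]
    · rwa [play_three]
    · rw [play_five]
      apply hasThreat_of_edges (u := a) (v := f) (w := c) (x := d) <;>
        simp [redAfter, blueAfter, *]
  · rw [play_seven]
    split_ifs with hzcd
    · apply hasK4_of_edges (u := a) (v := f) (w := d) (x := e) <;>
        simp [redAfter, *]
    · apply hasK4_of_edges (u := a) (v := f) (w := c) (x := d) <;>
        simp [redAfter, *]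
  · rw [play_seven]
    apply blueSafe z hzR
    intro w
    simp [blueAfter]
    tauto
end

section
/- Flaw in Beck's case L(4): Consider a position in the K^4-building game on ten distinct vertices A, B, C, D, K, L, M, P1, P2, P3 in which the red (first player's) edges are exactly AC, AK, AB, BC, BD, CD, BP1, BP2, BP3, BM, CL, MP1 and the blue (second player's) edges are exactly BL, KC, KB, KM, AD, ML, CP1, CP2, KL, CM, KP1, KP2, with all other edges unclaimed and the first player to move. Then: (i) the blue edges admit two threats with distinct unclaimed missing edges, namely on {K, C, P1, P2} missing P1P2 and on {K, C, M, P2} missing MP2; (ii) there is no 4-element vertex set carrying five red edges with the sixth edge unclaimed; consequently, whatever unclaimed edge the first player claims next, she does not complete a red K^4 and the second player can then claim an unclaimed edge completing a blue K^4. Hence the second player wins from this position. -/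
/-- Claiming the missing edge of a threat completes a `K^4`. -/
theorem IsThreat.hasK4_union {C O : Set (Sym2 ℕ)} {t : Finset ℕ} {x : Sym2 ℕ}
    (h : IsThreat C O t x) : HasK4 (C ∪ {x}) := by
  obtain ⟨hcard, -, -, -, hC⟩ := h
  refine ⟨t, hcard, fun u hu v hv huv => ?_⟩
  by_cases he : s(u, v) = x
  · exact Or.inr he
  · exact Or.inl (hC u hu v hv huv he)

/-- The missing edge of a threat is not a loop. -/
theorem IsThreat.not_isDiag {C O : Set (Sym2 ℕ)} {t : Finset ℕ} {x : Sym2 ℕ}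
    (h : IsThreat C O t x) : ¬ x.IsDiag := by
  obtain ⟨-, ⟨u, -, v, -, huv, rfl⟩, -⟩ := h
  simpa using huv

/-- Two elements of a 4-element set can be completed to an enumeration of distinct elements. -/
theorem Finset.exists_two_others {t : Finset ℕ} (ht : t.card = 4) {u v : ℕ}
    (hu : u ∈ t) (hv : v ∈ t) (huv : u ≠ v) :
    ∃ p ∈ t, ∃ q ∈ t, p ≠ q ∧ p ≠ u ∧ p ≠ v ∧ q ≠ u ∧ q ≠ v := by
  have hcard : ((t.erase u).erase v).card = 2 := by
    rw [Finset.card_erase_of_mem (by simp [hv, huv.symm]), Finset.card_erase_of_mem hu, ht]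
  obtain ⟨p, q, hpq, he⟩ := Finset.card_eq_two.mp hcard
  have hp : p ∈ (t.erase u).erase v := by simp [he]
  have hq : q ∈ (t.erase u).erase v := by simp [he]
  simp only [Finset.mem_erase] at hp hq
  exact ⟨p, hp.2.2, q, hq.2.2, hpq, hp.2.1, hp.1, hq.2.1, hq.1⟩

/-- Suppose `e ∉ C`, and any two distinct common neighbours in `C` of two adjacent vertices are the
ends of `e`. If all edges on a 4-element set other than `x` lie in `C`, then `x = e`. -/
theorem eq_of_forall_mem_of_ne {C : Set (Sym2 ℕ)} {e : Sym2 ℕ} (he : e ∉ C)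
    (hC : ∀ u v p q : ℕ, u ≠ v → s(p, q) ∈ C → s(u, p) ∈ C → s(u, q) ∈ C →
      s(v, p) ∈ C → s(v, q) ∈ C → s(u, v) = e)
    {t : Finset ℕ} (ht : t.card = 4) {x : Sym2 ℕ}
    (hx : ∀ u ∈ t, ∀ v ∈ t, u ≠ v → s(u, v) ≠ x → s(u, v) ∈ C) : x = e := by
  by_cases hxt : ∃ u ∈ t, ∃ v ∈ t, u ≠ v ∧ x = s(u, v)
  · obtain ⟨u, hu, v, hv, huv, rfl⟩ := hxt
    obtain ⟨p, hp, q, hq, hpq, hpu, hpv, hqu, hqv⟩ := Finset.exists_two_others ht hu hv huv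
    refine hC u v p q huv (hx p hp q hq hpq ?_) (hx u hu p hp hpu.symm ?_)
      (hx u hu q hq hqu.symm ?_) (hx v hv p hp hpv.symm ?_) (hx v hv q hq hqv.symm ?_) <;>
    · simp only [ne_eq, Sym2.eq_iff]
      omega
  · have hmem : ∀ u ∈ t, ∀ v ∈ t, u ≠ v → s(u, v) ∈ C := fun u hu v hv huv =>
      hx u hu v hv huv fun h => hxt ⟨u, hu, v, hv, huv, h.symm⟩
    obtain ⟨u, hu, v, hv, huv⟩ := Finset.one_lt_card.mp (by omega : 1 < t.card)
    obtain ⟨p, hp, q, hq, hpq, hpu, hpv, hqu, hqv⟩ := Finset.exists_two_others ht hu hv huv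
    have huv_eq : s(u, v) = e := hC u v p q huv (hmem p hp q hq hpq) (hmem u hu p hp hpu.symm)
      (hmem u hu q hq hqu.symm) (hmem v hv p hp hpv.symm) (hmem v hv q hq hqv.symm)
    exact absurd (huv_eq ▸ hmem u hu v hv huv) he

set_option maxHeartbeats 800000 in
/-- The flaw in Beck's case L(4): in the displayed position (arising when the
first player follows the strategy of case L(4)), with the first player to
move, (i) the blue edges admit two threats with distinct unclaimed missing
edges, on `{K, C, P1, P2}` missing `P1P2` and on `{K, C, M, P2}` missing
`MP2`; (ii) there is no 4-element vertex set carrying five red edges with the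
sixth edge unclaimed; consequently (iii) whatever unclaimed edge the first
player claims next, she does not complete a red `K^4` and the second player
can then claim an unclaimed edge completing a blue `K^4`.  Hence the second
player wins from this position. -/
theorem beck_case_L4_flaw
    (vA vB vC vD vK vL vM vP1 vP2 vP3 : ℕ)
    (hdist : ([vA, vB, vC, vD, vK, vL, vM, vP1, vP2, vP3] : List ℕ).Nodup)
    (R Bl : Finset (Sym2 ℕ))
    (hR : R = {s(vA, vC), s(vA, vK), s(vA, vB), s(vB, vC), s(vB, vD),
      s(vC, vD), s(vB, vP1), s(vB, vP2), s(vB, vP3), s(vB, vM), s(vC, vL),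
      s(vM, vP1)})
    (hBl : Bl = {s(vB, vL), s(vK, vC), s(vK, vB), s(vK, vM), s(vA, vD),
      s(vM, vL), s(vC, vP1), s(vC, vP2), s(vK, vL), s(vC, vM), s(vK, vP1),
      s(vK, vP2)}) :
    (IsThreat ↑Bl ↑R {vK, vC, vP1, vP2} s(vP1, vP2) ∧
      IsThreat ↑Bl ↑R {vK, vC, vM, vP2} s(vM, vP2) ∧
      s(vP1, vP2) ≠ s(vM, vP2)) ∧
    ¬ HasThreat ↑R ↑Bl ∧
    (∀ x : Sym2 ℕ, ¬ x.IsDiag → x ∉ R → x ∉ Bl →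
      ¬ HasK4 (↑R ∪ {x}) ∧
      ∃ y : Sym2 ℕ, ¬ y.IsDiag ∧ y ∉ R ∧ y ∉ Bl ∧ y ≠ x ∧
        HasK4 (↑Bl ∪ {y})) := by
  have hdist_symm := List.nodup_reverse.mpr hdist
  simp only [List.reverse_cons, List.reverse_nil, List.nil_append, List.cons_append,
    List.nodup_cons, List.mem_cons, List.not_mem_nil, or_false, not_or] at hdist_symm
  simp only [List.nodup_cons, List.mem_cons, List.not_mem_nil, or_false, not_or] at hdist
  have hred : ∀ u v p q : ℕ, u ≠ v → s(p, q) ∈ R → s(u, p) ∈ R → s(u, q) ∈ R →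
      s(v, p) ∈ R → s(v, q) ∈ R → s(u, v) = s(vA, vD) := by
    intro u v p q huv hpq hup huq hvp hvq
    simp only [hR, Finset.mem_insert, Finset.mem_singleton, Sym2.eq_iff] at hpq hup huq hvp hvq ⊢
    rcases hpq with h | h | h | h | h | h | h | h | h | h | h | h <;>
    rcases h with ⟨rfl, rfl⟩ | ⟨rfl, rfl⟩ <;>
    simp only [hdist, hdist_symm, and_true, and_false, or_false, false_or]
      at hup huq hvp hvq <;>
    grind only
  have hADR : s(vA, vD) ∉ R := by
    simp [hR, hdist, hdist_symm]
  have hADBl : s(vA, vD) ∈ Bl := by simp [hBl]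
  have hP1P2 : IsThreat ↑Bl ↑R {vK, vC, vP1, vP2} s(vP1, vP2) := by
    refine ⟨?_, ⟨vP1, by simp, vP2, by simp, by simp [hdist], rfl⟩, ?_, ?_, ?_⟩
    · simp [hdist, hdist_symm]
    · simp [hBl, hdist, hdist_symm]
    · simp [hR, hdist, hdist_symm]
    · simp only [hBl, Finset.mem_coe, Finset.mem_insert, Finset.mem_singleton, ne_eq]
      rintro u (rfl | rfl | rfl | rfl) v (rfl | rfl | rfl | rfl) <;> simp [Sym2.eq_swap]
  have hMP2 : IsThreat ↑Bl ↑R {vK, vC, vM, vP2} s(vM, vP2) := by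
    refine ⟨?_, ⟨vM, by simp, vP2, by simp, by simp [hdist], rfl⟩, ?_, ?_, ?_⟩
    · simp [hdist, hdist_symm]
    · simp [hBl, hdist, hdist_symm]
    · simp [hR, hdist, hdist_symm]
    · simp only [hBl, Finset.mem_coe, Finset.mem_insert, Finset.mem_singleton, ne_eq]
      rintro u (rfl | rfl | rfl | rfl) v (rfl | rfl | rfl | rfl) <;> simp [Sym2.eq_swap]
  have hne : s(vP1, vP2) ≠ s(vM, vP2) := by
    simp [hdist, hdist_symm]
  refine ⟨⟨hP1P2, hMP2, hne⟩, ?_, fun x _ _ hxBl => ⟨?_, ?_⟩⟩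
  · rintro ⟨t, x, ht, -, -, hxO, hC⟩
    exact hxO (eq_of_forall_mem_of_ne (C := ↑R) hADR hred ht hC ▸ hADBl)
  · rintro ⟨t, ht, hK4⟩
    exact hxBl (eq_of_forall_mem_of_ne (C := ↑R) hADR hred ht
      (fun u hu v hv huv hux => (hK4 u hu v hv huv).resolve_right hux) ▸ hADBl)
  · by_cases hx : s(vP1, vP2) = x
    · exact ⟨s(vM, vP2), hMP2.not_isDiag, hMP2.2.2.2.1, hMP2.2.2.1, hx ▸ hne.symm,
        hMP2.hasK4_union⟩
    · exact ⟨s(vP1, vP2), hP1P2.not_isDiag, hP1P2.2.2.2.1, hP1P2.2.2.1, hx,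
        hP1P2.hasK4_union⟩
end
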